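/- arXiv:2412.12899 — 4 statements merged into one kernel-verified Lean document; each statement's English description precedes it below -/
import Mathlib

section
/- If z̄ ∈ Ω is not a stationary point, then there exists s̄ ∈ Ω such that s̄ − z̄ is a descent direction of V at z̄, i.e., there exist s̄ ∈ Ω and t̂ > 0 such that for all t ∈ (0, t̂), V(z̄) − V(z̄ + t·(s̄ − z̄)) ∈ int C. -/
open Metric Set

/-- The oriented distance function associated with the cone `C`:
`φ_C(y) = d(y, -C) - d(y, ℝ^m \\ (-C))`. -/
noncomputable def phiC {m : ℕ} (C : Set (EuclideanSpace ℝ (Fin m)))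
    (y : EuclideanSpace ℝ (Fin m)) : ℝ :=
  Metric.infDist y (-C) - Metric.infDist y ((-C)ᶜ)

/-- The interior of a set closed under scaling by positive reals is closed under such scaling. -/
theorem smul_mem_interior_of_pos {E : Type*} [AddCommGroup E] [Module ℝ E] [TopologicalSpace E]
    [ContinuousConstSMul ℝ E] {C : Set E} (hC : ∀ a ∈ C, ∀ l : ℝ, 0 < l → l • a ∈ C)
    {x : E} (hx : x ∈ interior C) {t : ℝ} (ht : 0 < t) : t • x ∈ interior C := by
  have h : (fun y : E => t • y) '' interior C ⊆ interior C :=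
    interior_maximal (by rintro _ ⟨y, hy, rfl⟩; exact hC y (interior_subset hy) t ht)
      (isOpenMap_smul₀ ht.ne' _ isOpen_interior)
  exact h ⟨x, hx, rfl⟩

theorem descent_direction_of_not_stationary {m n : ℕ}
    (C : Set (EuclideanSpace ℝ (Fin m)))
    (hclosed : IsClosed C) (hconv : Convex ℝ C)
    (hcone : ∀ a ∈ C, ∀ l : ℝ, 0 ≤ l → l • a ∈ C)
    (hpointed : C ∩ (-C) = {0})
    (hint : (interior C).Nonempty)
    (Ω : Set (EuclideanSpace ℝ (Fin n)))
    (hΩne : Ω.Nonempty) (hΩcpt : IsCompact Ω) (hΩconv : Convex ℝ Ω)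
    (V : EuclideanSpace ℝ (Fin n) → EuclideanSpace ℝ (Fin m))
    (hV : ContDiff ℝ 1 V)
    (zbar : EuclideanSpace ℝ (Fin n)) (hzbar : zbar ∈ Ω)
    (hnotstat : ¬ ∀ s ∈ Ω, fderiv ℝ V zbar (s - zbar) ∉ -(interior C)) :
    ∃ sbar ∈ Ω, ∃ that : ℝ, 0 < that ∧ ∀ t ∈ Set.Ioo (0:ℝ) that,
      V zbar - V (zbar + t • (sbar - zbar)) ∈ interior C := by
  push Not at hnotstat
  obtain ⟨s, hs, hdesc⟩ := hnotstat
  have hderiv : HasLineDerivAt ℝ V (fderiv ℝ V zbar (s - zbar)) zbar (s - zbar) :=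
    ((hV.differentiable one_ne_zero).differentiableAt.hasFDerivAt).hasLineDerivAt _
  have hev := hderiv.tendsto_slope_zero_right.eventually
    (isOpen_interior.neg.mem_nhds hdesc)
  obtain ⟨r, hr, hsub⟩ := mem_nhdsGT_iff_exists_Ioo_subset.mp hev
  refine ⟨s, hs, r, hr, fun t ht => ?_⟩
  have hquot : -(t⁻¹ • (V (zbar + t • (s - zbar)) - V zbar)) ∈ interior C := hsub ht
  have hscaled := smul_mem_interior_of_pos (fun a ha l hl => hcone a ha l hl.le) hquot ht.1
  rwa [smul_neg, smul_inv_smul₀ ht.1.ne', neg_sub] at hscaled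
end

section
/- Let z ∈ Ω with θ(z) < 0, let s ∈ Ω be a minimizer of s ↦ φ_C(JV(z)(s − z)) over Ω, set d = s − z, and let β ∈ (0,1) and t ∈ (0,1] satisfy the Armijo condition V(z) + β·t·JV(z)(d) − V(z + t·d) ∈ C. Then V(z) − V(z + t·d) ∈ int C. -/
open Metric Set

/-- The optimal value `θ(z) = min_{s ∈ Ω} φ_C (JV(z)(s - z))`. -/
noncomputable def theta {m n : ℕ} (C : Set (EuclideanSpace ℝ (Fin m)))
    (Ω : Set (EuclideanSpace ℝ (Fin n)))
    (V : EuclideanSpace ℝ (Fin n) → EuclideanSpace ℝ (Fin m))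
    (z : EuclideanSpace ℝ (Fin n)) : ℝ :=
  sInf ((fun s => phiC C (fderiv ℝ V z (s - z))) '' Ω)

/-- In a convex cone, adding a positive multiple of an interior point gives an interior point. -/
theorem Convex.add_smul_mem_interior_of_cone {E : Type*} [NormedAddCommGroup E] [NormedSpace ℝ E]
    {C : Set E} (hconv : Convex ℝ C) (hcone : ∀ a ∈ C, ∀ l : ℝ, 0 ≤ l → l • a ∈ C)
    {a u : E} (ha : a ∈ C) (hu : u ∈ interior C) {c : ℝ} (hc : 0 < c) :
    a + c • u ∈ interior C := by
  have hopen : IsOpen ((fun x => c⁻¹ • (x - a)) ⁻¹' interior C) :=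
    isOpen_interior.preimage (by fun_prop)
  refine interior_maximal ?_ hopen ?_
  · intro x hx
    have hxC : x - a ∈ C := by
      simpa [smul_smul, hc.ne'] using hcone _ (interior_subset hx) c hc.le
    have hmid := hconv ha hxC (by norm_num : (0 : ℝ) ≤ 1 / 2)
      (by norm_num : (0 : ℝ) ≤ 1 / 2) (by norm_num)
    have hsum := hcone _ hmid 2 (by norm_num)
    rw [← smul_add, smul_smul] at hsum
    simpa using hsum
  · simpa [smul_smul, hc.ne'] using hu

/-- A point with negative oriented distance lies in the interior of `-C`. -/
theorem neg_mem_interior_of_phiC_neg {m : ℕ} {C : Set (EuclideanSpace ℝ (Fin m))}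
    {y : EuclideanSpace ℝ (Fin m)} (hy : phiC C y < 0) : -y ∈ interior C := by
  have hmem : y ∈ interior (-C) := by
    rw [← notMem_compl_iff, ← closure_compl]
    intro h
    have hdist : 0 ≤ infDist y (-C) := infDist_nonneg
    rw [phiC, infDist_zero_of_mem_closure h] at hy
    linarith
  exact interior_maximal (fun x hx => by simpa using interior_subset (s := -C) hx)
    (isOpen_interior.preimage continuous_neg) (show - -y ∈ interior (-C) by simpa using hmem)

theorem armijo_step_strict_descent {m n : ℕ}
    (C : Set (EuclideanSpace ℝ (Fin m)))
    (hclosed : IsClosed C) (hconv : Convex ℝ C)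
    (hcone : ∀ a ∈ C, ∀ l : ℝ, 0 ≤ l → l • a ∈ C)
    (hpointed : C ∩ (-C) = {0})
    (hint : (interior C).Nonempty)
    (Ω : Set (EuclideanSpace ℝ (Fin n)))
    (hΩne : Ω.Nonempty) (hΩcpt : IsCompact Ω) (hΩconv : Convex ℝ Ω)
    (V : EuclideanSpace ℝ (Fin n) → EuclideanSpace ℝ (Fin m))
    (hV : ContDiff ℝ 1 V)
    (z : EuclideanSpace ℝ (Fin n)) (hz : z ∈ Ω)
    (hθ : theta C Ω V z < 0)
    (sz : EuclideanSpace ℝ (Fin n)) (hsz : sz ∈ Ω)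
    (hszmin : ∀ s ∈ Ω,
      phiC C (fderiv ℝ V z (sz - z)) ≤ phiC C (fderiv ℝ V z (s - z)))
    (β t : ℝ) (hβ : β ∈ Set.Ioo (0:ℝ) 1) (htt : t ∈ Set.Ioc (0:ℝ) 1)
    (harmijo : V z + (β * t) • (fderiv ℝ V z (sz - z)) - V (z + t • (sz - z)) ∈ C) :
    V z - V (z + t • (sz - z)) ∈ interior C := by
  obtain ⟨_, ⟨s, hs, rfl⟩, hneg⟩ := exists_lt_of_csInf_lt (hΩne.image _) hθ
  have hu := neg_mem_interior_of_phiC_neg ((hszmin s hs).trans_lt hneg)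
  convert hconv.add_smul_mem_interior_of_cone hcone harmijo hu (mul_pos hβ.1 htt.1) using 1
  rw [smul_neg]
  abel
end

section
/- Let z ∈ Ω with θ(z) < 0, let s ∈ Ω be a minimizer of s ↦ φ_C(JV(z)(s − z)) over Ω, set d = s − z, and let β ∈ (0,1) and t ∈ (0,1] satisfy the Armijo condition V(z) + β·t·JV(z)(d) − V(z + t·d) ∈ C. Then φ_C(V(z + t·d)) ≤ φ_C(V(z)) + β·t·θ(z); in particular, t·|θ(z)| ≤ β⁻¹·(φ_C(V(z)) − φ_C(V(z + t·d))). -/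
open Metric Set

section OrientedDistance

variable {m : ℕ} {C : Set (EuclideanSpace ℝ (Fin m))}

theorem phiC_of_mem {y : EuclideanSpace ℝ (Fin m)} (hy : y ∈ -C) :
    phiC C y = -infDist y (-C)ᶜ := by
  simp [phiC, infDist_zero_of_mem hy]

theorem phiC_of_notMem {y : EuclideanSpace ℝ (Fin m)} (hy : y ∉ -C) :
    phiC C y = infDist y (-C) := by
  simp [phiC, infDist_zero_of_mem (mem_compl hy)]

theorem phiC_le_infDist (y : EuclideanSpace ℝ (Fin m)) : phiC C y ≤ infDist y (-C) :=
  sub_le_self _ infDist_nonneg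

theorem phiC_le_neg_of_add_mem (hne : (-C)ᶜ.Nonempty) {y : EuclideanSpace ℝ (Fin m)} {r : ℝ}
    (hr : 0 < r) (h : ∀ u : EuclideanSpace ℝ (Fin m), ‖u‖ < r → y + u ∈ -C) :
    phiC C y ≤ -r := by
  rw [phiC_of_mem (by simpa using h 0 (by simpa using hr)), neg_le_neg_iff, le_infDist hne]
  intro w hw
  by_contra! hlt
  exact hw (by simpa using h (w - y) (by rwa [← dist_eq_norm, dist_comm]))

theorem add_mem_of_norm_le_infDist_compl {K : Set (EuclideanSpace ℝ (Fin m))} (hK : IsClosed K)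
    {y v : EuclideanSpace ℝ (Fin m)} (hy : y ∈ K) (hv : ‖v‖ ≤ infDist y Kᶜ) : y + v ∈ K := by
  rw [← hK.closure_eq]
  exact closedBall_infDist_compl_subset_closure hy (by simpa using hv)

/-- The oriented distance is subadditive when the set is closed under addition. -/
theorem phiC_add_le (hclosed : IsClosed C) (hne : C.Nonempty)
    (hadd : ∀ a ∈ C, ∀ b ∈ C, a + b ∈ C) (x y : EuclideanSpace ℝ (Fin m)) :
    phiC C (x + y) ≤ phiC C x + phiC C y := by
  have hK : IsClosed (-C) := hclosed.neg
  have hKne : (-C).Nonempty := hne.neg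
  have hKadd : ∀ {a b}, a ∈ -C → b ∈ -C → a + b ∈ -C := fun {a b} ha hb => by
    simpa [add_comm] using hadd _ ha _ hb
  obtain huniv | hcne := (-C)ᶜ.eq_empty_or_nonempty
  · simp [phiC, compl_empty_iff.mp huniv, infDist_zero_of_mem]
  have mixed : ∀ x y, x ∉ -C → y ∈ -C → phiC C (x + y) ≤ phiC C x + phiC C y := by
    intro x y hx hy
    obtain ⟨k, hk, hxk⟩ := hK.exists_infDist_eq_dist hKne x
    rw [phiC_of_notMem hx, phiC_of_mem hy, hxk, dist_eq_norm]
    set r := infDist y (-C)ᶜ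
    have hr0 : 0 ≤ r := infDist_nonneg
    obtain hle | hlt := le_or_gt r ‖x - k‖
    · have hpos : 0 < ‖x - k‖ := norm_pos_iff.mpr (sub_ne_zero.mpr fun h => hx (h ▸ hk))
      have hmem : k + (y + (r / ‖x - k‖) • (x - k)) ∈ -C := by
        refine hKadd hk (add_mem_of_norm_le_infDist_compl hK hy ?_)
        rw [norm_smul, Real.norm_of_nonneg (by positivity), div_mul_cancel₀ _ hpos.ne']
      refine (phiC_le_infDist _).trans ((infDist_le_dist_of_mem hmem).trans_eq ?_)
      have : x + y - (k + (y + (r / ‖x - k‖) • (x - k))) = (1 - r / ‖x - k‖) • (x - k) := by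
        module
      rw [dist_eq_norm, this, norm_smul,
        Real.norm_of_nonneg (sub_nonneg.mpr ((div_le_one hpos).mpr hle))]
      field_simp
      ring
    · rw [show ‖x - k‖ + -r = -(r - ‖x - k‖) by ring]
      refine phiC_le_neg_of_add_mem hcne (sub_pos.mpr hlt) fun u hu => ?_
      have : x + y + u = k + (y + (x - k + u)) := by abel
      rw [this]
      refine hKadd hk (add_mem_of_norm_le_infDist_compl hK hy ((norm_add_le _ _).trans ?_))
      linarith
  by_cases hx : x ∈ -C <;> by_cases hy : y ∈ -C
  · rw [phiC_of_mem hx, phiC_of_mem hy, ← neg_add]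
    set r := infDist x (-C)ᶜ
    set q := infDist y (-C)ᶜ
    have hr0 : 0 ≤ r := infDist_nonneg
    have hq0 : 0 ≤ q := infDist_nonneg
    obtain h0 | hpos := (add_nonneg hr0 hq0).eq_or_lt
    · rw [← h0, phiC_of_mem (hKadd hx hy)]
      exact neg_le_neg infDist_nonneg
    refine phiC_le_neg_of_add_mem hcne hpos fun u hu => ?_
    have hsplit : x + y + u = (x + (r / (r + q)) • u) + (y + (q / (r + q)) • u) := by
      have : r / (r + q) + q / (r + q) = 1 := by rw [← add_div, div_self hpos.ne']
      rw [add_add_add_comm, ← add_smul, this, one_smul]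
    have hbound : ∀ p : ℝ, 0 ≤ p → ‖(p / (r + q)) • u‖ ≤ p := fun p hp => by
      rw [norm_smul, Real.norm_of_nonneg (by positivity), div_mul_eq_mul_div, div_le_iff₀ hpos]
      gcongr
    rw [hsplit]
    exact hKadd (add_mem_of_norm_le_infDist_compl hK hx (hbound r hr0))
      (add_mem_of_norm_le_infDist_compl hK hy (hbound q hq0))
  · rw [add_comm x, add_comm (phiC C x)]
    exact mixed y x hy hx
  · exact mixed x y hx hy
  · obtain ⟨k, hk, hxk⟩ := hK.exists_infDist_eq_dist hKne x
    obtain ⟨l, hl, hyl⟩ := hK.exists_infDist_eq_dist hKne y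
    rw [phiC_of_notMem hx, phiC_of_notMem hy, hxk, hyl]
    exact (phiC_le_infDist _).trans
      ((infDist_le_dist_of_mem (hKadd hk hl)).trans (dist_add_add_le _ _ _ _))

open scoped Pointwise in
theorem phiC_smul (hcone : ∀ a ∈ C, ∀ l : ℝ, 0 ≤ l → l • a ∈ C) {l : ℝ} (hl : 0 < l)
    (y : EuclideanSpace ℝ (Fin m)) : phiC C (l • y) = l * phiC C y := by
  have hK : l • (-C) = -C := by
    ext w
    rw [mem_smul_set_iff_inv_smul_mem₀ hl.ne', Set.mem_neg, Set.mem_neg, ← smul_neg]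
    refine ⟨fun h => ?_, fun h => hcone _ h _ (by positivity)⟩
    simpa [smul_smul, hl.ne'] using hcone _ h l hl.le
  have hKc : l • (-C)ᶜ = (-C)ᶜ := by
    ext w
    rw [mem_smul_set_iff_inv_smul_mem₀ hl.ne', mem_compl_iff, mem_compl_iff,
      ← mem_smul_set_iff_inv_smul_mem₀ hl.ne', hK]
  have h₁ := infDist_smul₀ hl.ne' (-C) y
  have h₂ := infDist_smul₀ hl.ne' (-C)ᶜ y
  rw [hK, Real.norm_of_nonneg hl.le] at h₁
  rw [hKc, Real.norm_of_nonneg hl.le] at h₂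
  rw [phiC, phiC, h₁, h₂, mul_sub]

end OrientedDistance

theorem armijo_step_phiC_decrease {m n : ℕ}
    (C : Set (EuclideanSpace ℝ (Fin m)))
    (hclosed : IsClosed C) (hconv : Convex ℝ C)
    (hcone : ∀ a ∈ C, ∀ l : ℝ, 0 ≤ l → l • a ∈ C)
    (hpointed : C ∩ (-C) = {0})
    (hint : (interior C).Nonempty)
    (Ω : Set (EuclideanSpace ℝ (Fin n)))
    (hΩne : Ω.Nonempty) (hΩcpt : IsCompact Ω) (hΩconv : Convex ℝ Ω)
    (V : EuclideanSpace ℝ (Fin n) → EuclideanSpace ℝ (Fin m))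
    (hV : ContDiff ℝ 1 V)
    (z : EuclideanSpace ℝ (Fin n)) (hz : z ∈ Ω)
    (hθ : theta C Ω V z < 0)
    (sz : EuclideanSpace ℝ (Fin n)) (hsz : sz ∈ Ω)
    (hszmin : ∀ s ∈ Ω,
      phiC C (fderiv ℝ V z (sz - z)) ≤ phiC C (fderiv ℝ V z (s - z)))
    (β t : ℝ) (hβ : β ∈ Set.Ioo (0:ℝ) 1) (htt : t ∈ Set.Ioc (0:ℝ) 1)
    (harmijo : V z + (β * t) • (fderiv ℝ V z (sz - z)) - V (z + t • (sz - z)) ∈ C) :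
    phiC C (V (z + t • (sz - z))) ≤ phiC C (V z) + β * t * theta C Ω V z ∧
    t * |theta C Ω V z| ≤ β⁻¹ * (phiC C (V z) - phiC C (V (z + t • (sz - z)))) := by
  have hadd : ∀ a ∈ C, ∀ b ∈ C, a + b ∈ C := fun a ha b hb => by
    have h := hcone _ (hconv ha hb (by norm_num : (0 : ℝ) ≤ 1 / 2) (by norm_num : (0 : ℝ) ≤ 1 / 2)
      (by norm_num)) 2 (by norm_num)
    simpa [smul_smul] using h
  have hne : C.Nonempty := hint.mono interior_subset
  set d := fderiv ℝ V z (sz - z)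
  have htheta : theta C Ω V z = phiC C d :=
    IsLeast.csInf_eq ⟨⟨sz, hsz, rfl⟩, by rintro _ ⟨s, hs, rfl⟩; exact hszmin s hs⟩
  have hβt : 0 < β * t := mul_pos hβ.1 htt.1
  have hmono : phiC C (V (z + t • (sz - z)) - (V z + (β * t) • d)) ≤ 0 := by
    rw [phiC_of_mem (by simpa using harmijo)]
    exact neg_nonpos.mpr infDist_nonneg
  have hdecrease : phiC C (V (z + t • (sz - z))) ≤ phiC C (V z) + β * t * theta C Ω V z := by
    have h₁ := phiC_add_le hclosed hne hadd (V z + (β * t) • d)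
      (V (z + t • (sz - z)) - (V z + (β * t) • d))
    have h₂ := phiC_add_le hclosed hne hadd (V z) ((β * t) • d)
    rw [add_sub_cancel] at h₁
    rw [phiC_smul hcone hβt] at h₂
    rw [htheta]
    linarith
  refine ⟨hdecrease, ?_⟩
  rw [abs_of_neg hθ, le_inv_mul_iff₀ hβ.1]
  linarith
end

section
/- Let (z_k) be a sequence generated by the improved conditional gradient algorithm with the Armijo step rule. Then every cluster point ẑ of (z_k) (i.e., every limit of a convergent subsequence) is a stationary point: JV(ẑ)(s − ẑ) ∉ −int C for every s ∈ Ω. -/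
open Metric Set

open Filter Topology Asymptotics

theorem interior_set_neg {E : Type*} [AddGroup E] [TopologicalSpace E] [ContinuousNeg E]
    (s : Set E) : interior (-s) = -interior s :=
  ((Homeomorph.neg E).preimage_interior s).symm

section OrientedDistance

variable {m : ℕ} {C : Set (EuclideanSpace ℝ (Fin m))}

theorem continuous_phiC : Continuous (phiC C) :=
  (continuous_infDist_pt _).sub (continuous_infDist_pt _)

theorem phiC_univ (y : EuclideanSpace ℝ (Fin m)) : phiC univ y = 0 := by
  simp [phiC, infDist_zero_of_mem]

theorem mem_neg_interior_of_phiC_neg {y : EuclideanSpace ℝ (Fin m)} (h : phiC C y < 0) :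
    y ∈ -interior C := by
  by_contra hy
  have hcl : y ∈ closure (-C)ᶜ := by
    rwa [closure_compl, mem_compl_iff, interior_set_neg]
  have h0 := infDist_zero_of_mem_closure hcl
  have h1 : 0 ≤ infDist y (-C) := infDist_nonneg
  unfold phiC at h
  linarith

theorem phiC_neg_of_mem_neg_interior (hC : C ≠ univ) {y : EuclideanSpace ℝ (Fin m)}
    (hy : y ∈ -interior C) : phiC C y < 0 := by
  have hne : ((-C)ᶜ).Nonempty := by
    obtain ⟨x, hx⟩ := (ne_univ_iff_exists_notMem C).1 hC
    exact ⟨-x, by simpa using hx⟩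
  have hcl : y ∉ closure (-C)ᶜ := by
    rw [closure_compl, interior_set_neg]
    exact not_not.2 hy
  have h0 : infDist y (-C) = 0 := infDist_zero_of_mem (Set.neg_subset_neg.2 interior_subset hy)
  have h1 := (infDist_pos_iff_notMem_closure hne).1 hcl
  unfold phiC
  linarith

end OrientedDistance

section Cone

open Pointwise

variable {E : Type*} [NormedAddCommGroup E] [NormedSpace ℝ E] {C : Set E}

theorem Convex.add_mem_of_smul_mem (hconv : Convex ℝ C)
    (hcone : ∀ a ∈ C, ∀ l : ℝ, 0 ≤ l → l • a ∈ C) {a b : E} (ha : a ∈ C) (hb : b ∈ C) :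
    a + b ∈ C := by
  have h := hconv (hcone a ha 2 (by norm_num)) (hcone b hb 2 (by norm_num))
    (a := 1 / 2) (b := 1 / 2) (by norm_num) (by norm_num) (by norm_num)
  simpa [smul_smul] using h

theorem eq_univ_of_zero_mem_interior (hcone : ∀ a ∈ C, ∀ l : ℝ, 0 ≤ l → l • a ∈ C)
    (h0 : (0 : E) ∈ interior C) : C = univ := by
  refine eq_univ_of_forall fun y => ?_
  have hlim : Tendsto (fun r : ℝ => r • y) (𝓝[>] 0) (𝓝 0) := by
    have h : Tendsto (fun r : ℝ => r • y) (𝓝 0) (𝓝 ((0 : ℝ) • y)) :=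
      (continuous_id.smul continuous_const).tendsto 0
    rw [zero_smul] at h
    exact h.mono_left nhdsWithin_le_nhds
  obtain ⟨r, hr, hr0⟩ :=
    ((hlim.eventually (mem_interior_iff_mem_nhds.1 h0)).and self_mem_nhdsWithin).exists
  have hr0 : 0 < r := hr0
  have h := hcone _ hr r⁻¹ (inv_nonneg.2 hr0.le)
  rwa [smul_smul, inv_mul_cancel₀ hr0.ne', one_smul] at h

theorem smul_mem_interior_of_pos_s18 (hcone : ∀ a ∈ C, ∀ l : ℝ, 0 ≤ l → l • a ∈ C)
    {a : E} (ha : a ∈ interior C) {l : ℝ} (hl : 0 < l) : l • a ∈ interior C := by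
  have hsub : l • interior C ⊆ C := by
    rintro _ ⟨x, hx, rfl⟩
    exact hcone x (interior_subset hx) l hl.le
  exact interior_maximal hsub (isOpen_interior.smul₀ hl.ne') (smul_mem_smul_set ha)

end Cone

theorem HasStrictFDerivAt.tendsto_inv_smul_sub {ι E F : Type*} [NormedAddCommGroup E]
    [NormedSpace ℝ E] [NormedAddCommGroup F] [NormedSpace ℝ F] {l : Filter ι} {f : E → F}
    {f' : E →L[ℝ] F} {x : E} (hf : HasStrictFDerivAt f f' x) {z d : ι → E} {d₀ : E} {τ : ι → ℝ}
    (hz : Tendsto z l (𝓝 x)) (hd : Tendsto d l (𝓝 d₀)) (hτ : Tendsto τ l (𝓝 0))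
    (hτ0 : ∀ i, τ i ≠ 0) :
    Tendsto (fun i => (τ i)⁻¹ • (f (z i + τ i • d i) - f (z i))) l (𝓝 (f' d₀)) := by
  have hz' : Tendsto (fun i => z i + τ i • d i) l (𝓝 x) := by
    simpa using hz.add (hτ.smul hd)
  have hO : (fun i => τ i • d i) =O[l] τ := by
    simpa using (isBigO_refl τ l).smul (hd.isBigO_one ℝ)
  have ho := hf.isLittleO.comp_tendsto (hz'.prodMk_nhds hz)
  have ho' : (fun i => f (z i + τ i • d i) - f (z i) - f' (τ i • d i)) =o[l] τ := by
    refine IsLittleO.trans_isBigO ?_ hO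
    simpa [Function.comp_def] using ho
  have h := ho'.tendsto_inv_smul_nhds_zero.add ((f'.continuous.tendsto d₀).comp hd)
  rw [zero_add] at h
  refine h.congr fun i => ?_
  simp [smul_sub, smul_smul, inv_mul_cancel₀ (hτ0 i)]


theorem Filter.Tendsto.clm_apply_nhds {ι E F : Type*} [NormedAddCommGroup E]
    [NormedSpace ℝ E] [NormedAddCommGroup F] [NormedSpace ℝ F] {l : Filter ι}
    {f : ι → E →L[ℝ] F} {g : ι → E} {f₀ : E →L[ℝ] F} {g₀ : E}
    (hf : Tendsto f l (𝓝 f₀)) (hg : Tendsto g l (𝓝 g₀)) :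
    Tendsto (fun i => f i (g i)) l (𝓝 (f₀ g₀)) :=
  (isBoundedBilinearMap_apply.continuous.tendsto (f₀, g₀)).comp (hf.prodMk_nhds hg)

theorem icgm_cluster_point_stationary {m n : ℕ}
    (C : Set (EuclideanSpace ℝ (Fin m)))
    (hclosed : IsClosed C) (hconv : Convex ℝ C)
    (hcone : ∀ a ∈ C, ∀ l : ℝ, 0 ≤ l → l • a ∈ C)
    (hpointed : C ∩ (-C) = {0})
    (hint : (interior C).Nonempty)
    (Ω : Set (EuclideanSpace ℝ (Fin n)))
    (hΩne : Ω.Nonempty) (hΩcpt : IsCompact Ω) (hΩconv : Convex ℝ Ω)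
    (V : EuclideanSpace ℝ (Fin n) → EuclideanSpace ℝ (Fin m))
    (hV : ContDiff ℝ 1 V)
    (β δ : ℝ) (hβ : β ∈ Set.Ioo (0:ℝ) 1) (hδ : δ ∈ Set.Ioo (0:ℝ) 1)
    (z s : ℕ → EuclideanSpace ℝ (Fin n)) (t : ℕ → ℝ) (nk : ℕ → ℕ)
    (hz0 : z 0 ∈ Ω)
    (hsΩ : ∀ k, s k ∈ Ω)
    (hsmin : ∀ k, ∀ u ∈ Ω,
      phiC C (fderiv ℝ V (z k) (s k - z k)) ≤ phiC C (fderiv ℝ V (z k) (u - z k)))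
    (hθ : ∀ k, theta C Ω V (z k) < 0)
    (harm : ∀ k,
      V (z k) + (β * δ ^ nk k) • (fderiv ℝ V (z k) (s k - z k))
        - V (z k + (δ ^ nk k) • (s k - z k)) ∈ C)
    (hleast : ∀ k, ∀ j < nk k,
      V (z k) + (β * δ ^ j) • (fderiv ℝ V (z k) (s k - z k))
        - V (z k + (δ ^ j) • (s k - z k)) ∉ C)
    (ht : ∀ k, t k = δ ^ nk k)
    (hrec : ∀ k, z (k + 1) = z k + t k • (s k - z k))
    (zhat : EuclideanSpace ℝ (Fin n))
    (hcluster : ∃ φ : ℕ → ℕ, StrictMono φ ∧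
      Filter.Tendsto (fun j => z (φ j)) Filter.atTop (nhds zhat)) :
    ∀ u ∈ Ω, fderiv ℝ V zhat (u - zhat) ∉ -(interior C) := by
  obtain ⟨φ, hφ, hzφ⟩ := hcluster
  obtain ⟨shat, -, σ, hσ, hsσ⟩ := hΩcpt.tendsto_subseq fun j => hsΩ (φ j)
  set ψ : ℕ → ℕ := φ ∘ σ
  have hψ : StrictMono ψ := hφ.comp hσ
  have hz : Tendsto (fun j => z (ψ j)) atTop (𝓝 zhat) := hzφ.comp hσ.tendsto_atTop
  have hs : Tendsto (fun j => s (ψ j)) atTop (𝓝 shat) := hsσ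
  have hd := hs.sub hz
  have hfd : Tendsto (fun j => fderiv ℝ V (z (ψ j))) atTop (𝓝 (fderiv ℝ V zhat)) :=
    ((hV.continuous_fderiv one_ne_zero).tendsto zhat).comp hz
  have hJd : Tendsto (fun j => fderiv ℝ V (z (ψ j)) (s (ψ j) - z (ψ j))) atTop
      (𝓝 (fderiv ℝ V zhat (shat - zhat))) := hfd.clm_apply_nhds hd
  have hCuniv : C ≠ univ := by
    rintro rfl
    have h := hθ 0
    simp only [theta, phiC_univ, hΩne.image_const, csInf_singleton, lt_irrefl] at h
  have hJd_neg : ∀ k, -fderiv ℝ V (z k) (s k - z k) ∈ C := by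
    intro k
    obtain ⟨_, ⟨v, hv, rfl⟩, hlt⟩ := exists_lt_of_csInf_lt (hΩne.image _) (hθ k)
    have h := mem_neg_interior_of_phiC_neg ((hsmin k v hv).trans_lt hlt)
    exact interior_subset (mem_neg.1 h)
  intro u hu hmem
  set w := fderiv ℝ V zhat (shat - zhat)
  have hw_int : -w ∈ interior C := by
    refine mem_neg_interior_of_phiC_neg (lt_of_le_of_lt ?_
      (phiC_neg_of_mem_neg_interior hCuniv hmem))
    exact le_of_tendsto_of_tendsto' ((continuous_phiC.tendsto _).comp hJd)
      ((continuous_phiC.tendsto _).comp (hfd.clm_apply_nhds (tendsto_const_nhds.sub hz)))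
      fun j => hsmin (ψ j) u hu
  have hadd : ∀ {a b}, a ∈ C → b ∈ C → a + b ∈ C :=
    fun ha hb => hconv.add_mem_of_smul_mem hcone ha hb
  by_cases hn : Tendsto (fun j => nk (ψ j)) atTop atTop
  · have hτ : Tendsto (fun j => δ ^ (nk (ψ j) - 1)) atTop (𝓝 0) :=
      (tendsto_pow_atTop_nhds_zero_of_lt_one hδ.1.le hδ.2).comp
        ((tendsto_sub_atTop_nat 1).comp hn)
    have hstrict : HasStrictFDerivAt V (fderiv ℝ V zhat) zhat :=
      hV.contDiffAt.hasStrictFDerivAt one_ne_zero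
    have hlim := (hJd.const_smul β).sub
      (hstrict.tendsto_inv_smul_sub hz hd hτ fun j => (pow_pos hδ.1 _).ne')
    have hlim_mem : β • w - w ∈ interior C := by
      have h := smul_mem_interior_of_pos_s18 hcone hw_int (sub_pos.2 hβ.2)
      convert h using 1
      module
    obtain ⟨j, hj, hj1⟩ := ((hlim.eventually (isOpen_interior.mem_nhds hlim_mem)).and
      (hn.eventually_ge_atTop 1)).exists
    have hpos : 0 < δ ^ (nk (ψ j) - 1) := pow_pos hδ.1 _
    refine hleast (ψ j) (nk (ψ j) - 1) (by omega) ?_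
    have h := hcone _ (interior_subset hj) _ hpos.le
    rw [smul_sub, smul_smul, smul_smul, mul_inv_cancel₀ hpos.ne', one_smul] at h
    convert h using 1
    rw [mul_comm]
    abel
  · obtain ⟨b, hb⟩ : ∃ b, ∃ᶠ j in atTop, nk (ψ j) < b := by
      simpa only [Filter.tendsto_atTop, not_forall, not_eventually, not_le] using hn
    have hstep : ∀ k, V (z k) - V (z (k + 1))
        + (β * δ ^ nk k) • fderiv ℝ V (z k) (s k - z k) ∈ C := by
      intro k
      have h := harm k
      rw [← ht k, ← hrec k, ht k] at h
      convert h using 1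
      abel
    have hzero : (0 : EuclideanSpace ℝ (Fin m)) ∈ C := by
      simpa using hcone _ (hJd_neg 0) 0 le_rfl
    have hdec : ∀ k i, V (z k) - V (z (k + i)) ∈ C := by
      intro k i
      induction i with
      | zero => simpa using hzero
      | succ i ih =>
        have h := hadd ih (hadd (hstep (k + i)) (hcone _ (hJd_neg (k + i)) (β * δ ^ nk (k + i))
          (mul_nonneg hβ.1.le (pow_nonneg hδ.1.le _))))
        convert h using 1
        rw [← add_assoc k i 1]
        module
    have hVz : Tendsto (fun j => V (z (ψ j))) atTop (𝓝 (V zhat)) :=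
      (hV.continuous.tendsto zhat).comp hz
    have hlim := (hVz.sub (hVz.comp (tendsto_add_atTop_nat 1))).add
      (hJd.const_smul (β * δ ^ b))
    rw [sub_self, zero_add] at hlim
    have hmemC : (β * δ ^ b) • w ∈ C := by
      refine hclosed.mem_of_frequently_of_tendsto (hb.mono fun j hj => ?_) hlim
      obtain ⟨i, hi⟩ := Nat.exists_eq_add_of_le (Nat.succ_le_of_lt (hψ (Nat.lt_succ_self j)))
      have hle : β * δ ^ b ≤ β * δ ^ nk (ψ j) :=
        mul_le_mul_of_nonneg_left (pow_le_pow_of_le_one hδ.1.le hδ.2.le hj.le) hβ.1.le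
      have h := hadd (hadd (hstep (ψ j)) (hdec (ψ j + 1) i))
        (hcone _ (hJd_neg (ψ j)) _ (sub_nonneg.2 hle))
      convert h using 1
      simp only [Function.comp_apply, Nat.succ_eq_add_one] at hi ⊢
      rw [hi]
      module
    have hpos : 0 < β * δ ^ b := mul_pos hβ.1 (pow_pos hδ.1 _)
    have hwC : w ∈ C := by
      have h := hcone _ hmemC (β * δ ^ b)⁻¹ (inv_nonneg.2 hpos.le)
      rwa [smul_smul, inv_mul_cancel₀ hpos.ne', one_smul] at h
    have hw0 : w = 0 := by
      have h : w ∈ C ∩ -C := ⟨hwC, mem_neg.2 (interior_subset hw_int)⟩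
      rwa [hpointed] at h
    rw [hw0, neg_zero] at hw_int
    exact hCuniv (eq_univ_of_zero_mem_interior hcone hw_int)
end
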